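/- arXiv:2312.16590 — 3 statements merged into one kernel-verified Lean document; each statement's English description precedes it below -/
import Mathlib

section
/- Let K be an algebraically closed field of characteristic zero, let d ≥ 1 and ℓ ≥ 2, and let B ⊆ Δ_ℓ(d) be basepoint-free and concise such that Λ := ⟨B⟩ has rank 2 and e_i − e_j ∉ Λ for all i ≠ j. Then Λ satisfies the secant condition over K if and only if there exists a permutation σ of {0,…,ℓ} such that the image of Λ under the coordinate permutation of ℤ^{ℓ+1} induced by σ equals one of the five Table 1 lattices (in particular ℓ + 1 ∈ {3,4,5,6}). (This is the rank-two theorem: for general marked points, the center of the projection defining C_{B,f} meets no unmarked secant of the rational normal curve exactly when ⟨B⟩ is one of the exceptional lattices of Table 1.) -/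
/-- `Delta n d` is the set Δ(d) of integer vectors in `ℤ^n` with nonnegative
entries summing to `d`.  (For the paper's Δ_ℓ(d) take `n = ℓ + 1`.) -/
def Delta (n d : ℕ) : Set (Fin n → ℤ) :=
  {u | (∀ i, 0 ≤ u i) ∧ ∑ i, u i = (d : ℤ)}

/-- A subset `B ⊆ ℤ^n` is basepoint-free if for every index `i` there is
`v ∈ B` with `v i = 0`. -/
def Basepointfree {n : ℕ} (B : Set (Fin n → ℤ)) : Prop :=
  ∀ i, ∃ v ∈ B, v i = 0

/-- A subset `B ⊆ ℤ^n` is concise if for every index `i` there is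
`v ∈ B` with `v i ≠ 0`. -/
def Concise {n : ℕ} (B : Set (Fin n → ℤ)) : Prop :=
  ∀ i, ∃ v ∈ B, v i ≠ 0

/-- `latticeOf B` is the subgroup ⟨B⟩ of `ℤ^n` generated by all differences
of elements of `B`. -/
def latticeOf {n : ℕ} (B : Set (Fin n → ℤ)) : AddSubgroup (Fin n → ℤ) :=
  AddSubgroup.closure {x | ∃ v ∈ B, ∃ w ∈ B, x = v - w}

/-- `Λ` satisfies the secant condition over `K` if for every point `z` of the
quasitorus `Y(Λ) = {z ∈ (Kˣ)^n : z^v = 1 ∀ v ∈ Λ}` there is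
`(a,b) ≠ (0,0)` such that the vector `(a zᵢ + b zᵢ⁻¹)ᵢ` lies in `Λ^⊥_K`. -/
def SecantCondition (K : Type*) [Field K] {n : ℕ} (Λ : AddSubgroup (Fin n → ℤ)) : Prop :=
  ∀ z : Fin n → K, (∀ i, z i ≠ 0) → (∀ v ∈ Λ, ∏ i, z i ^ (v i) = 1) →
    ∃ a b : K, (a, b) ≠ (0, 0) ∧
      ∀ v ∈ Λ, ∑ i, (a * z i + b * (z i)⁻¹) * ((v i : ℤ) : K) = 0

/-- The vector in `ℤ^n` whose `i`-th entry is the `i`-th entry of the list `l`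
(or `0` if the list is too short). -/
def tVec {n : ℕ} (l : List ℤ) : Fin n → ℤ := fun i => l.getD i.val 0

/-- `Λ ⊆ ℤ^n` is (equal to) one of the five exceptional lattices of
Table 1 of the paper. -/
def IsTableLattice {n : ℕ} (Λ : AddSubgroup (Fin n → ℤ)) : Prop :=
  (n = 6 ∧ Λ = AddSubgroup.closure {tVec [1, 1, -1, -1, 0, 0], tVec [1, 1, 0, 0, -1, -1]}) ∨
  (n = 5 ∧ Λ = AddSubgroup.closure {tVec [2, -1, -1, 0, 0], tVec [2, 0, 0, -1, -1]}) ∨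
  (n = 4 ∧ Λ = AddSubgroup.closure {tVec [2, -2, 0, 0], tVec [2, 0, -1, -1]}) ∨
  (n = 3 ∧ Λ = AddSubgroup.closure {tVec [2, -2, 0], tVec [2, 0, -2]}) ∨
  (n = 3 ∧ Λ = AddSubgroup.closure {tVec [2, -2, 0], tVec [2, -1, -1]})

/-- The additive automorphism of `ℤ^n` permuting coordinates according to `σ`. -/
def permMap {n : ℕ} (σ : Equiv.Perm (Fin n)) : (Fin n → ℤ) →+ (Fin n → ℤ) where
  toFun v := v ∘ σ
  map_zero' := rfl
  map_add' _ _ := rfl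

theorem exists_torus_point_ne_one (K : Type*) [Field K] [IsAlgClosed K] [CharZero K] {n : ℕ}
    (Λ : AddSubgroup (Fin n → ℤ)) {x : Fin n → ℤ} (hx : x ∉ Λ) :
    ∃ z : Fin n → Kˣ, (∀ v ∈ Λ, ∏ i, z i ^ v i = 1) ∧ ∏ i, z i ^ x i ≠ 1 := by
  have hx' : (QuotientAddGroup.mk x : (Fin n → ℤ) ⧸ Λ) ≠ 0 := by
    rwa [Ne, QuotientAddGroup.eq_zero_iff]
  obtain ⟨c, hc⟩ := CharacterModule.exists_character_apply_ne_zero_of_ne_zero hx'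
  let c' : (Fin n → ℤ) →+ AddCircle (1 : ℚ) :=
    AddMonoidHom.comp (c : ((Fin n → ℤ) ⧸ Λ) →+ AddCircle (1 : ℚ)) (QuotientAddGroup.mk' Λ)
  have tors : IsAddTorsion (AddCircle (1 : ℚ)) := by
    intro y
    induction y using QuotientAddGroup.induction_on with
    | H y =>
      rw [isOfFinAddOrder_iff_nsmul_eq_zero]
      refine ⟨y.den, y.den_pos, ?_⟩
      rw [← AddCircle.coe_nsmul, AddCircle.coe_eq_zero_iff]
      exact ⟨y.num, by simp [Rat.den_mul_eq_num]⟩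
  have : AddGroup.FG c'.range := AddGroup.fg_range c'
  have : Finite c'.range := AddCommGroup.finite_of_fg_isAddTorsion _ (tors.addSubgroup _)
  let g : Multiplicative c'.range := Multiplicative.ofAdd (c'.rangeRestrict x)
  have hg : g ≠ 1 := by
    intro h
    exact hc (congrArg Subtype.val (Multiplicative.ofAdd.injective h))
  have : NeZero ((Monoid.exponent (Multiplicative c'.range) : ℕ)) := inferInstance
  obtain ⟨φ, hφ⟩ := CommGroup.exists_apply_ne_one_of_hasEnoughRootsOfUnity
    (Multiplicative c'.range) K hg
  let ψ : Multiplicative (Fin n → ℤ) →* Kˣ := φ.comp (AddMonoidHom.toMultiplicative c'.rangeRestrict)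
  have key : ∀ v : Fin n → ℤ,
      ∏ i, ψ (Multiplicative.ofAdd (Pi.single i 1)) ^ v i = ψ (Multiplicative.ofAdd v) := by
    intro v
    simp_rw [← map_zpow, ← map_prod, ← ofAdd_zsmul, ← ofAdd_sum]
    congr 2
    exact (pi_eq_sum_univ' v).symm ▸ by simp [Pi.single_apply]
  refine ⟨fun i => ψ (Multiplicative.ofAdd (Pi.single i 1)), fun v hv => ?_, ?_⟩
  · rw [key]
    have : c'.rangeRestrict v = 0 := by
      apply Subtype.ext
      have : (QuotientAddGroup.mk' Λ v) = 0 := by simpa using hv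
      change c (QuotientAddGroup.mk' Λ v) = 0
      rw [this]; exact map_zero c
    change φ (Multiplicative.ofAdd (c'.rangeRestrict v)) = 1
    rw [this]; simp
  · rw [key]; exact hφ

/-- The points of the quasitorus of `Λ`, as a subgroup of the torus. -/
def torusSubgroup (K : Type*) [Field K] {n : ℕ} (Λ : AddSubgroup (Fin n → ℤ)) :
    Subgroup (Fin n → Kˣ) where
  carrier := {z | ∀ v ∈ Λ, ∏ i, z i ^ v i = 1}
  mul_mem' ha hb v hv := by
    simp only [Pi.mul_apply, mul_zpow, Finset.prod_mul_distrib, ha v hv, hb v hv, mul_one]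
  one_mem' v _ := by simp
  inv_mem' ha v hv := by
    simp only [Pi.inv_apply, inv_zpow, Finset.prod_inv_distrib, ha v hv, inv_one]

/-- The character `z ↦ z i / z j` of the quasitorus. -/
def rootChar (K : Type*) [Field K] {n : ℕ} (Λ : AddSubgroup (Fin n → ℤ)) (i j : Fin n) :
    torusSubgroup K Λ →* K where
  toFun z := ((z.1 i * (z.1 j)⁻¹ : Kˣ) : K)
  map_one' := by simp
  map_mul' a b := by push_cast [Subgroup.coe_mul, Pi.mul_apply]; simp; ring

theorem mem_of_rootChar_eq {K : Type*} [Field K] [IsAlgClosed K] [CharZero K] {n : ℕ}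
    {Λ : AddSubgroup (Fin n → ℤ)} {i j k l : Fin n}
    (h : rootChar K Λ k l = rootChar K Λ i j) :
    (Pi.single i 1 - Pi.single j 1 + Pi.single l 1 - Pi.single k 1 : Fin n → ℤ) ∈ Λ := by
  by_contra hx
  obtain ⟨z, hz, hzx⟩ := exists_torus_point_ne_one K Λ hx
  apply hzx
  have := congrArg (fun f => f ⟨z, hz⟩) h
  have h2 : z k * (z l)⁻¹ = z i * (z j)⁻¹ := Units.ext this
  have hs : ∀ m : Fin n, ∏ x, z x ^ ((Pi.single m 1 : Fin n → ℤ) x) = z m := by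
    intro m
    rw [Finset.prod_eq_single m] <;> simp +contextual
  simp only [Pi.sub_apply, Pi.add_apply, zpow_add, zpow_sub, Finset.prod_mul_distrib,
    Finset.prod_inv_distrib, hs]
  rw [← h2]; group

theorem sum_minor_mul_eq_zero {K : Type*} [Field K] {n : ℕ}
    {Λ : AddSubgroup (Fin n → ℤ)} (hS : SecantCondition K Λ) {p q : Fin n → ℤ}
    (hp : p ∈ Λ) (hq : q ∈ Λ) (z : torusSubgroup K Λ) :
    ∑ i, ∑ j, ((p i * q j - q i * p j : ℤ) : K) * rootChar K Λ i j z = 0 := by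
  obtain ⟨a, b, hab, h⟩ := hS (fun i => (z.1 i : K)) (fun i => (z.1 i).ne_zero) (fun v hv => by
    have := congrArg (Units.val) (z.2 v hv)
    simpa using this)
  have hp := h p hp
  have hq := h q hq
  simp only [add_mul, mul_assoc, Finset.sum_add_distrib, ← Finset.mul_sum] at hp hq
  set P := ∑ i, (z.1 i : K) * (p i : K)
  set P' := ∑ i, (z.1 i : K)⁻¹ * (p i : K)
  set Q := ∑ i, (z.1 i : K) * (q i : K)
  set Q' := ∑ i, (z.1 i : K)⁻¹ * (q i : K)
  have key : P * Q' - Q * P' = 0 := by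
    by_contra hne
    apply hab
    have ha : a * (P * Q' - Q * P') = 0 := by linear_combination Q' * hp - P' * hq
    have hb : b * (P * Q' - Q * P') = 0 := by linear_combination P * hq - Q * hp
    simp_all
  rw [← key, Finset.sum_mul_sum, Finset.sum_mul_sum, ← Finset.sum_sub_distrib]
  refine Finset.sum_congr rfl fun i _ => ?_
  rw [← Finset.sum_sub_distrib]
  refine Finset.sum_congr rfl fun j _ => ?_
  simp only [rootChar, MonoidHom.coe_mk, OneHom.coe_mk]
  push_cast
  ring

theorem exists_partner {K : Type*} [Field K] [IsAlgClosed K] [CharZero K] {n : ℕ}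
    {Λ : AddSubgroup (Fin n → ℤ)} (hS : SecantCondition K Λ) {p q : Fin n → ℤ}
    (hp : p ∈ Λ) (hq : q ∈ Λ) {i j : Fin n} (hij : 0 < p i * q j - q i * p j) :
    ∃ l k, 0 < p l * q k - q l * p k ∧
      (Pi.single i 1 - Pi.single j 1 + Pi.single l 1 - Pi.single k 1 : Fin n → ℤ) ∈ Λ := by
  classical
  let D : Fin n × Fin n → ℤ := fun x => p x.1 * q x.2 - q x.1 * p x.2
  let χ : Fin n × Fin n → (torusSubgroup K Λ →* K) := fun x => rootChar K Λ x.1 x.2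
  let c : (torusSubgroup K Λ →* K) → K := fun f => ∑ x with χ x = f, (D x : K)
  have hsum : ∑ f ∈ Finset.univ.image χ, c f • (f : torusSubgroup K Λ → K) = 0 := by
    ext z
    have := sum_minor_mul_eq_zero hS hp hq z
    rw [← Fintype.sum_prod_type'] at this
    rw [Finset.sum_apply, Pi.zero_apply, ← this,
      ← Finset.sum_fiberwise_of_maps_to (g := χ) (t := Finset.univ.image χ) (by simp)]
    refine Finset.sum_congr rfl fun f _ => ?_
    simp only [c, Pi.smul_apply, smul_eq_mul, Finset.sum_mul]
    refine Finset.sum_congr rfl fun x hx => ?_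
    rw [← (Finset.mem_filter.1 hx).2]
  have hc := linearIndependent_iff'.1 (linearIndependent_monoidHom (torusSubgroup K Λ) K)
    (Finset.univ.image χ) c hsum (χ (i, j)) (by simp)
  have hc' : ∑ x with χ x = χ (i, j), D x = 0 := by
    have : ((∑ x with χ x = χ (i, j), D x : ℤ) : K) = 0 := by push_cast; exact hc
    exact_mod_cast this
  obtain ⟨x, hx, hneg⟩ := Finset.exists_lt_of_sum_lt (s := Finset.univ.filter (χ · = χ (i, j)))
    (f := D) (g := fun x => if x = (i, j) then 1 else 0) (by simp [hc'])
  have hx' := (Finset.mem_filter.1 hx).2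
  have hxij : x ≠ (i, j) := by
    rintro rfl
    simp [D] at hneg; omega
  refine ⟨x.2, x.1, ?_, mem_of_rootChar_eq hx'⟩
  simp only [hxij, if_false, D] at hneg
  linarith [mul_comm (p x.1) (q x.2), mul_comm (p x.2) (q x.1)]

/-- A lattice `Λ` together with its `2 × 2` minors `D` satisfying the combinatorial form of the
secant condition. -/
structure PartnerConfig {n : ℕ} (Λ : AddSubgroup (Fin n → ℤ)) (D : Fin n → Fin n → ℤ) : Prop where
  antisymm : ∀ i j, D j i = - D i j
  plucker : ∀ v ∈ Λ, ∀ i j k, v i * D j k + v j * D k i + v k * D i j = 0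
  row_sum : ∀ i, ∑ j, D i j = 0
  exists_ne : ∀ i, ∃ j, D i j ≠ 0
  parallel_trans : ∀ i j k, D i j = 0 → D j k = 0 → D i k = 0
  sum_eq_zero : ∀ v ∈ Λ, ∑ i, v i = 0
  sub_notMem : ∀ i j, i ≠ j → (Pi.single i 1 - Pi.single j 1 : Fin n → ℤ) ∉ Λ
  partner : ∀ i j, 0 < D i j → ∃ l k, 0 < D l k ∧ l ≠ j ∧ i ≠ k ∧
    (Pi.single i 1 - Pi.single j 1 + Pi.single l 1 - Pi.single k 1 : Fin n → ℤ) ∈ Λ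

theorem exists_partnerConfig {K : Type*} [Field K] [IsAlgClosed K] [CharZero K] {n : ℕ}
    {Λ : AddSubgroup (Fin n → ℤ)} (hS : SecantCondition K Λ)
    (hrank : Module.finrank ℤ (AddSubgroup.toIntSubmodule Λ) = 2)
    (hne : ∀ i j, i ≠ j → (Pi.single i 1 - Pi.single j 1 : Fin n → ℤ) ∉ Λ)
    (hsum : ∀ v ∈ Λ, ∑ i, v i = 0) (hnz : ∀ i, ∃ v ∈ Λ, v i ≠ 0) :
    ∃ D, PartnerConfig Λ D := by
  let b := Module.finBasisOfFinrankEq ℤ (AddSubgroup.toIntSubmodule Λ) hrank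
  obtain ⟨p, hpb⟩ : ∃ p, p = b 0 := ⟨_, rfl⟩
  obtain ⟨q, hqb⟩ : ∃ q, q = b 1 := ⟨_, rfl⟩
  have hp : p.1 ∈ Λ := p.2
  have hq : q.1 ∈ Λ := q.2
  have hli : ∀ s t : ℤ, s • p.1 + t • q.1 = 0 → s = 0 ∧ t = 0 := by
    intro s t h
    have h' : s • p + t • q = 0 := Subtype.ext h
    have := Fintype.linearIndependent_iff.1 b.linearIndependent ![s, t]
      (by simpa [Fin.sum_univ_two, ← hpb, ← hqb] using h')
    exact ⟨this 0, this 1⟩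
  have hspan : ∀ v ∈ Λ, ∃ s t : ℤ, ∀ i, v i = s * p.1 i + t * q.1 i := by
    intro v hv
    have := b.sum_repr ⟨v, hv⟩
    rw [Fin.sum_univ_two, ← hpb, ← hqb] at this
    refine ⟨b.repr ⟨v, hv⟩ 0, b.repr ⟨v, hv⟩ 1, fun i => ?_⟩
    · have := congrFun (congrArg Subtype.val this) i
      exact this.symm
  have hcol : ∀ i, p.1 i ≠ 0 ∨ q.1 i ≠ 0 := by
    intro i
    obtain ⟨v, hv, hvi⟩ := hnz i
    obtain ⟨s, t, h⟩ := hspan v hv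
    by_contra! hc
    simp [h, hc.1, hc.2] at hvi
  refine ⟨fun i j => p.1 i * q.1 j - q.1 i * p.1 j, ⟨?_, ?_, ?_, ?_, ?_, hsum, hne, ?_⟩⟩
  · intros; ring
  · intro v hv i j k
    obtain ⟨s, t, h⟩ := hspan v hv
    rw [h, h, h]; ring
  · intro i
    rw [Finset.sum_sub_distrib, ← Finset.mul_sum, ← Finset.mul_sum, hsum _ hp, hsum _ hq]
    ring
  · intro i
    by_contra! h
    have := hli (-q.1 i) (p.1 i) (by ext j; simpa [sub_eq_add_neg, add_comm] using h j)
    rcases hcol i with h1 | h1 <;> omega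
  · intro i j k h1 h2
    rcases hcol j with h | h
    · apply mul_left_cancel₀ h
      linear_combination p.1 k * h1 + p.1 i * h2
    · apply mul_left_cancel₀ h
      linear_combination q.1 k * h1 + q.1 i * h2
  · intro i j hij
    obtain ⟨l, k, hlk, hmem⟩ := exists_partner hS hp hq hij
    refine ⟨l, k, hlk, ?_, ?_, hmem⟩
    · rintro rfl
      have hik : i ≠ k := by rintro rfl; linarith [mul_comm (p.1 i) (q.1 l), mul_comm (p.1 l) (q.1 i)]
      exact hne i k hik (by simpa using hmem)
    · rintro rfl
      have hlj : l ≠ j := by rintro rfl; linarith [mul_comm (p.1 i) (q.1 l), mul_comm (p.1 l) (q.1 i)]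
      refine hne l j hlj ?_
      convert hmem using 1
      abel

namespace PartnerConfig

variable {n : ℕ} {Λ : AddSubgroup (Fin n → ℤ)} {D : Fin n → Fin n → ℤ}

theorem permute (h : PartnerConfig Λ D) (σ : Equiv.Perm (Fin n)) :
    PartnerConfig (Λ.map (permMap σ)) (fun i j => D (σ i) (σ j)) where
  antisymm i j := h.antisymm _ _
  plucker := by
    rintro _ ⟨v, hv, rfl⟩ i j k
    exact h.plucker v hv _ _ _
  row_sum i := (Equiv.sum_comp σ (fun j => D (σ i) j)).trans (h.row_sum _)
  exists_ne i := by
    obtain ⟨j, hj⟩ := h.exists_ne (σ i)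
    exact ⟨σ.symm j, by simpa using hj⟩
  parallel_trans i j k := h.parallel_trans _ _ _
  sum_eq_zero := by
    rintro _ ⟨v, hv, rfl⟩
    exact (Equiv.sum_comp σ v).trans (h.sum_eq_zero v hv)
  sub_notMem i j hij := by
    rintro ⟨v, hv, hvx⟩
    refine h.sub_notMem (σ i) (σ j) (by simpa using hij) ?_
    convert SetLike.mem_coe.1 hv using 1
    ext x
    have := congrFun hvx (σ.symm x)
    simp only [permMap, AddMonoidHom.coe_mk, ZeroHom.coe_mk, Function.comp,
      Equiv.apply_symm_apply] at this
    rw [this]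
    simp [Pi.single_apply, Equiv.symm_apply_eq]
  partner i j hij := by
    obtain ⟨l, k, hlk, h1, h2, hm⟩ := h.partner _ _ hij
    refine ⟨σ.symm l, σ.symm k, by simpa using hlk, by simpa [Equiv.symm_apply_eq] using h1,
      by simpa [Equiv.eq_symm_apply] using h2, _, hm, ?_⟩
    ext x
    simp [permMap, Pi.single_apply, Equiv.eq_symm_apply]

end PartnerConfig

theorem permMap_mul_map {n : ℕ} (Λ : AddSubgroup (Fin n → ℤ)) (σ τ : Equiv.Perm (Fin n)) :
    (Λ.map (permMap σ)).map (permMap τ) = Λ.map (permMap (σ * τ)) := by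
  rw [AddSubgroup.map_map]; rfl

/-- Some coordinate permutation of `Λ` is one of the exceptional lattices. -/
def IsTableUpToPerm {n : ℕ} (Λ : AddSubgroup (Fin n → ℤ)) : Prop :=
  ∃ σ : Equiv.Perm (Fin n), IsTableLattice (Λ.map (permMap σ))

theorem IsTableUpToPerm.of_map {n : ℕ} {Λ : AddSubgroup (Fin n → ℤ)} {σ : Equiv.Perm (Fin n)}
    (h : IsTableUpToPerm (Λ.map (permMap σ))) : IsTableUpToPerm Λ := by
  obtain ⟨τ, h⟩ := h
  exact ⟨σ * τ, by rwa [permMap_mul_map] at h⟩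

theorem exists_perm_extend {m n : ℕ} (hmn : m ≤ n) {f : Fin m → Fin n}
    (hf : Function.Injective f) :
    ∃ σ : Equiv.Perm (Fin n), ∀ i, σ (Fin.castLE hmn i) = f i := by
  let e := (Equiv.ofInjective _ (Fin.castLE_injective hmn)).symm.trans (Equiv.ofInjective _ hf)
  refine ⟨Equiv.extendSubtype (p := (· ∈ Set.range (Fin.castLE hmn)))
    (q := (· ∈ Set.range f)) e, fun i => ?_⟩
  rw [Equiv.extendSubtype_apply_of_mem _ _ (Set.mem_range_self i)]
  simp [e]

namespace PartnerConfig

/-- The entries of the relation `e i - e j + e l - e k`. -/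
def quadVec {n : ℕ} (i j l k x : Fin n) : ℤ :=
  (if x = i then 1 else 0) - (if x = j then 1 else 0) + (if x = l then 1 else 0) -
    (if x = k then 1 else 0)

theorem exists_quadVec {n : ℕ} {Λ : AddSubgroup (Fin n → ℤ)} {D : Fin n → Fin n → ℤ}
  (h : PartnerConfig Λ D) {i j : Fin n} (hij : 0 < D i j) :
    ∃ l k, quadVec i j l k ∈ Λ ∧ 0 < D l k ∧ l ≠ j ∧ i ≠ k := by
  obtain ⟨l, k, hlk, h1, h2, hm⟩ := h.partner i j hij
  refine ⟨l, k, ?_, hlk, h1, h2⟩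
  convert hm using 1
  ext x
  simp [quadVec, Pi.single_apply]

theorem plucker_four {Λ : AddSubgroup (Fin 4 → ℤ)} {D : Fin 4 → Fin 4 → ℤ}
    (h : PartnerConfig Λ D) {v : Fin 4 → ℤ} (hv : v ∈ Λ) :
    v 0 * D 1 2 - v 1 * D 0 2 + v 2 * D 0 1 = 0 ∧
    v 0 * D 1 3 - v 1 * D 0 3 + v 3 * D 0 1 = 0 ∧
    v 0 * D 2 3 - v 2 * D 0 3 + v 3 * D 0 2 = 0 ∧
    v 1 * D 2 3 - v 2 * D 1 3 + v 3 * D 1 2 = 0 := by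
  have a := h.antisymm
  have p := h.plucker v hv
  refine ⟨?_, ?_, ?_, ?_⟩
  · linear_combination p 0 1 2 - v 1 * a 0 2
  · linear_combination p 0 1 3 - v 1 * a 0 3
  · linear_combination p 0 2 3 - v 2 * a 0 3
  · linear_combination p 1 2 3 - v 2 * a 1 3

theorem row_four {Λ : AddSubgroup (Fin 4 → ℤ)} {D : Fin 4 → Fin 4 → ℤ}
    (h : PartnerConfig Λ D) :
    D 0 1 + D 0 2 + D 0 3 = 0 ∧ -D 0 1 + D 1 2 + D 1 3 = 0 ∧ -D 0 2 - D 1 2 + D 2 3 = 0 ∧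
    -D 0 3 - D 1 3 - D 2 3 = 0 := by
  have r := fun i => h.row_sum i
  simp only [Fin.sum_univ_four] at r
  have a := h.antisymm
  refine ⟨?_, ?_, ?_, ?_⟩
  · linarith [r 0, a 0 0]
  · linarith [r 1, a 0 1, a 1 1]
  · linarith [r 2, a 0 2, a 1 2, a 2 2]
  · linarith [r 3, a 0 3, a 1 3, a 2 3, a 3 3]

theorem anti_four {Λ : AddSubgroup (Fin 4 → ℤ)} {D : Fin 4 → Fin 4 → ℤ}
    (h : PartnerConfig Λ D) :
    D 0 0 = 0 ∧ D 1 1 = 0 ∧ D 2 2 = 0 ∧ D 3 3 = 0 ∧ D 1 0 = -D 0 1 ∧ D 2 0 = -D 0 2 ∧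
    D 3 0 = -D 0 3 ∧ D 2 1 = -D 1 2 ∧ D 3 1 = -D 1 3 ∧ D 3 2 = -D 2 3 := by
  have a := h.antisymm
  exact ⟨by linarith [a 0 0], by linarith [a 1 1], by linarith [a 2 2], by linarith [a 3 3],
    a _ _, a _ _, a _ _, a _ _, a _ _, a _ _⟩

theorem four_false_of_pos {Λ : AddSubgroup (Fin 4 → ℤ)} {D : Fin 4 → Fin 4 → ℤ}
    (h : PartnerConfig Λ D) (h1 : 0 < D 0 1) (h2 : 0 < D 0 2) (h3 : 0 < D 1 2)
    (h4 : D 1 3 ≠ 0) : False := by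
  obtain ⟨r0, r1, r2, r3⟩ := h.row_four
  obtain ⟨a0, a1, a2, a3, a4, a5, a6, a7, a8, a9⟩ := h.anti_four
  have h23 : 0 < D 2 3 := by omega
  have h30 : 0 < D 3 0 := by omega
  rcases lt_or_gt_of_ne h4 with h13 | h13
  · have h31 : 0 < D 3 1 := by omega
    obtain ⟨l, k, hm, hlk, hlj, hik⟩ := h.exists_quadVec h23
    have P := h.plucker_four hm
    clear hm
    fin_cases l <;> fin_cases k <;> simp [quadVec] at P hlk hlj hik <;> omega
  · obtain ⟨l, k, hm, hlk, hlj, hik⟩ := h.exists_quadVec h30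
    have P := h.plucker_four hm
    clear hm
    fin_cases l <;> fin_cases k <;> simp [quadVec] at P hlk hlj hik <;> omega

theorem four_parallel {Λ : AddSubgroup (Fin 4 → ℤ)} {D : Fin 4 → Fin 4 → ℤ}
    (h : PartnerConfig Λ D) (h01 : D 0 1 = 0) (h02 : 0 < D 0 2) :
    quadVec 2 3 2 3 ∈ Λ ∧ quadVec 0 2 1 2 ∈ Λ := by
  obtain ⟨r0, r1, r2, r3⟩ := h.row_four
  obtain ⟨a0, a1, a2, a3, a4, a5, a6, a7, a8, a9⟩ := h.anti_four
  have h30 : 0 < D 3 0 := by omega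
  have h12 : D 1 2 ≠ 0 := fun h12 => h02.ne' (h.parallel_trans _ _ _ h01 h12)
  have key : quadVec 0 2 1 2 ∈ Λ := by
    obtain ⟨l, k, hm, hlk, hlj, hik⟩ := h.exists_quadVec h02
    have P := h.plucker_four hm
    fin_cases l <;> fin_cases k <;> simp [quadVec] at P hlk hlj hik <;>
      first | omega | exact hm
  have P := h.plucker_four key
  simp [quadVec] at P
  have h23 : 0 < D 2 3 := by omega
  refine ⟨?_, key⟩
  obtain ⟨l, k, hm, hlk, hlj, hik⟩ := h.exists_quadVec h23
  have P := h.plucker_four hm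
  fin_cases l <;> fin_cases k <;> simp [quadVec] at P hlk hlj hik <;>
    first | omega | exact hm

theorem plucker_five {Λ : AddSubgroup (Fin 5 → ℤ)} {D : Fin 5 → Fin 5 → ℤ}
    (h : PartnerConfig Λ D) {v : Fin 5 → ℤ} (hv : v ∈ Λ) :
    v 0 * D 1 2 - v 1 * D 0 2 + v 2 * D 0 1 = 0 ∧
    v 0 * D 1 3 - v 1 * D 0 3 + v 3 * D 0 1 = 0 ∧
    v 0 * D 1 4 - v 1 * D 0 4 + v 4 * D 0 1 = 0 ∧
    v 0 * D 2 3 - v 2 * D 0 3 + v 3 * D 0 2 = 0 ∧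
    v 0 * D 2 4 - v 2 * D 0 4 + v 4 * D 0 2 = 0 ∧
    v 0 * D 3 4 - v 3 * D 0 4 + v 4 * D 0 3 = 0 ∧
    v 1 * D 2 3 - v 2 * D 1 3 + v 3 * D 1 2 = 0 ∧
    v 1 * D 2 4 - v 2 * D 1 4 + v 4 * D 1 2 = 0 ∧
    v 1 * D 3 4 - v 3 * D 1 4 + v 4 * D 1 3 = 0 ∧
    v 2 * D 3 4 - v 3 * D 2 4 + v 4 * D 2 3 = 0 := by
  have p : ∀ i j k, v i * D j k - v j * D i k + v k * D i j = 0 := fun i j k => by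
    linear_combination h.plucker v hv i j k - v j * h.antisymm i k
  exact ⟨p _ _ _, p _ _ _, p _ _ _, p _ _ _, p _ _ _, p _ _ _, p _ _ _, p _ _ _, p _ _ _, p _ _ _⟩

theorem plucker_six {Λ : AddSubgroup (Fin 6 → ℤ)} {D : Fin 6 → Fin 6 → ℤ}
    (h : PartnerConfig Λ D) {v : Fin 6 → ℤ} (hv : v ∈ Λ) :
    v 0 * D 1 2 - v 1 * D 0 2 + v 2 * D 0 1 = 0 ∧
    v 0 * D 1 3 - v 1 * D 0 3 + v 3 * D 0 1 = 0 ∧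
    v 0 * D 1 4 - v 1 * D 0 4 + v 4 * D 0 1 = 0 ∧
    v 0 * D 1 5 - v 1 * D 0 5 + v 5 * D 0 1 = 0 ∧
    v 0 * D 2 3 - v 2 * D 0 3 + v 3 * D 0 2 = 0 ∧
    v 0 * D 2 4 - v 2 * D 0 4 + v 4 * D 0 2 = 0 ∧
    v 0 * D 2 5 - v 2 * D 0 5 + v 5 * D 0 2 = 0 ∧
    v 0 * D 3 4 - v 3 * D 0 4 + v 4 * D 0 3 = 0 ∧
    v 0 * D 3 5 - v 3 * D 0 5 + v 5 * D 0 3 = 0 ∧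
    v 0 * D 4 5 - v 4 * D 0 5 + v 5 * D 0 4 = 0 ∧
    v 1 * D 2 3 - v 2 * D 1 3 + v 3 * D 1 2 = 0 ∧
    v 1 * D 2 4 - v 2 * D 1 4 + v 4 * D 1 2 = 0 ∧
    v 1 * D 2 5 - v 2 * D 1 5 + v 5 * D 1 2 = 0 ∧
    v 1 * D 3 4 - v 3 * D 1 4 + v 4 * D 1 3 = 0 ∧
    v 1 * D 3 5 - v 3 * D 1 5 + v 5 * D 1 3 = 0 ∧
    v 1 * D 4 5 - v 4 * D 1 5 + v 5 * D 1 4 = 0 ∧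
    v 2 * D 3 4 - v 3 * D 2 4 + v 4 * D 2 3 = 0 ∧
    v 2 * D 3 5 - v 3 * D 2 5 + v 5 * D 2 3 = 0 ∧
    v 2 * D 4 5 - v 4 * D 2 5 + v 5 * D 2 4 = 0 ∧
    v 3 * D 4 5 - v 4 * D 3 5 + v 5 * D 3 4 = 0 := by
  have p : ∀ i j k, v i * D j k - v j * D i k + v k * D i j = 0 := fun i j k => by
    linear_combination h.plucker v hv i j k - v j * h.antisymm i k
  exact ⟨p _ _ _, p _ _ _, p _ _ _, p _ _ _, p _ _ _, p _ _ _, p _ _ _, p _ _ _, p _ _ _, p _ _ _,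
    p _ _ _, p _ _ _, p _ _ _, p _ _ _, p _ _ _, p _ _ _, p _ _ _, p _ _ _, p _ _ _, p _ _ _⟩

theorem row_five {Λ : AddSubgroup (Fin 5 → ℤ)} {D : Fin 5 → Fin 5 → ℤ}
    (h : PartnerConfig Λ D) :
    D 0 1 + D 0 2 + D 0 3 + D 0 4 = 0 ∧ -D 0 1 + D 1 2 + D 1 3 + D 1 4 = 0 ∧
    -D 0 2 - D 1 2 + D 2 3 + D 2 4 = 0 ∧ -D 0 3 - D 1 3 - D 2 3 + D 3 4 = 0 ∧
    -D 0 4 - D 1 4 - D 2 4 - D 3 4 = 0 := by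
  have r := fun i => h.row_sum i
  simp only [Fin.sum_univ_five] at r
  have a := h.antisymm
  refine ⟨?_, ?_, ?_, ?_, ?_⟩
  · linarith [r 0, a 0 0]
  · linarith [r 1, a 0 1, a 1 1]
  · linarith [r 2, a 0 2, a 1 2, a 2 2]
  · linarith [r 3, a 0 3, a 1 3, a 2 3, a 3 3]
  · linarith [r 4, a 0 4, a 1 4, a 2 4, a 3 4, a 4 4]

theorem anti_five {Λ : AddSubgroup (Fin 5 → ℤ)} {D : Fin 5 → Fin 5 → ℤ}
    (h : PartnerConfig Λ D) :
    D 0 0 = 0 ∧ D 1 1 = 0 ∧ D 2 2 = 0 ∧ D 3 3 = 0 ∧ D 4 4 = 0 ∧ D 1 0 = -D 0 1 ∧ D 2 0 = -D 0 2 ∧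
    D 3 0 = -D 0 3 ∧ D 4 0 = - D 0 4 ∧ D 2 1 = -D 1 2 ∧ D 3 1 = -D 1 3 ∧ D 4 1 = -D 1 4 ∧
    D 3 2 = -D 2 3 ∧ D 4 2 = -D 2 4 ∧ D 4 3 = -D 3 4 := by
  have a := h.antisymm
  exact ⟨by linarith [a 0 0], by linarith [a 1 1], by linarith [a 2 2], by linarith [a 3 3],
    by linarith [a 4 4], a _ _, a _ _, a _ _, a _ _, a _ _, a _ _, a _ _, a _ _, a _ _, a _ _⟩

set_option maxHeartbeats 4000000 in
theorem five_triple {Λ : AddSubgroup (Fin 5 → ℤ)} {D : Fin 5 → Fin 5 → ℤ}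
    (h : PartnerConfig Λ D) (h01 : D 0 1 = 0) (h02 : D 0 2 = 0) (h03 : 0 < D 0 3) : False := by
  obtain ⟨r0, r1, r2, r3, r4⟩ := h.row_five
  obtain ⟨a0, a1, a2, a3, a4, a5, a6, a7, a8, a9, a10, a11, a12, a13, a14⟩ := h.anti_five
  have h12 : D 1 2 = 0 := h.parallel_trans 1 0 2 (by omega) h02
  have h13 : D 1 3 ≠ 0 := fun h13 => h03.ne' (h.parallel_trans _ _ _ h01 h13)
  have h23 : D 2 3 ≠ 0 := fun h23 => h03.ne' (h.parallel_trans _ _ _ h02 h23)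
  have h14 : D 1 4 ≠ 0 := by omega
  have h24 : D 2 4 ≠ 0 := by omega
  obtain ⟨l, k, hm, hlk, hlj, hik⟩ := h.exists_quadVec h03
  have P := h.plucker_five hm
  fin_cases l <;> fin_cases k <;> simp [quadVec] at P hlk hlj hik <;> grind only

set_option maxHeartbeats 4000000 in
theorem five_nonparallel {Λ : AddSubgroup (Fin 5 → ℤ)} {D : Fin 5 → Fin 5 → ℤ}
    (h : PartnerConfig Λ D) (h0 : ∀ i j, i ≠ j → D i j ≠ 0) (hm : quadVec 0 1 2 3 ∈ Λ) : False := by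
  obtain ⟨r0, r1, r2, r3, r4⟩ := h.row_five
  obtain ⟨a0, a1, a2, a3, a4, a5, a6, a7, a8, a9, a10, a11, a12, a13, a14⟩ := h.anti_five
  have h01 := h0 0 1 (by decide)
  have h02 := h0 0 2 (by decide)
  have h03 := h0 0 3 (by decide)
  have h04 := h0 0 4 (by decide)
  have h12 := h0 1 2 (by decide)
  have h13 := h0 1 3 (by decide)
  have h14 := h0 1 4 (by decide)
  have h23 := h0 2 3 (by decide)
  have h24 := h0 2 4 (by decide)
  have h34 := h0 3 4 (by decide)
  have P := h.plucker_five hm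
  simp [quadVec] at P
  rcases lt_or_gt_of_ne h02 with h02 | h02
  · have h20 : 0 < D 2 0 := by omega
    obtain ⟨l, k, hm, hlk, hlj, hik⟩ := h.exists_quadVec h20
    have P := h.plucker_five hm
    fin_cases l <;> fin_cases k <;> simp [quadVec] at P hlk hlj hik <;> grind only
  · obtain ⟨l, k, hm, hlk, hlj, hik⟩ := h.exists_quadVec h02
    have P := h.plucker_five hm
    fin_cases l <;> fin_cases k <;> simp [quadVec] at P hlk hlj hik <;> grind only

set_option maxHeartbeats 4000000 in
theorem five_pair {Λ : AddSubgroup (Fin 5 → ℤ)} {D : Fin 5 → Fin 5 → ℤ}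
    (h : PartnerConfig Λ D) (h01 : D 0 1 = 0) (h02 : 0 < D 0 2) (h03 : D 0 3 ≠ 0) (h04 : D 0 4 ≠ 0)
     (h23 : D 2 3 ≠ 0) (h24 : D 2 4 ≠ 0) (h34 : D 3 4 ≠ 0) : False := by
  obtain ⟨r0, r1, r2, r3, r4⟩ := h.row_five
  obtain ⟨a0, a1, a2, a3, a4, a5, a6, a7, a8, a9, a10, a11, a12, a13, a14⟩ := h.anti_five
  have h12 : D 1 2 ≠ 0 := fun h12 => h02.ne' (h.parallel_trans _ _ _ h01 h12)
  have h13 : D 1 3 ≠ 0 := fun h13 => h03 (h.parallel_trans _ _ _ h01 h13)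
  have h14 : D 1 4 ≠ 0 := fun h14 => h04 (h.parallel_trans _ _ _ h01 h14)
  obtain ⟨l, k, hm, hlk, hlj, hik⟩ := h.exists_quadVec h02
  have P := h.plucker_five hm
  fin_cases l <;> fin_cases k <;> simp [quadVec] at P hlk hlj hik <;> try grind only
  all_goals
    clear hlk hlj hik hm
    have h04' : 0 < D 0 4 ∨ 0 < D 4 0 := by omega
    have h03' : 0 < D 0 3 ∨ 0 < D 3 0 := by omega
  · clear h03'
    rcases h04' with h' | h'
    all_goals
      obtain ⟨l, k, hm, hlk, hlj, hik⟩ := h.exists_quadVec h'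
      have P := h.plucker_five hm
      clear hm
      fin_cases l <;> fin_cases k <;> simp [quadVec] at P hlk hlj hik <;> grind only
  · clear h04'
    rcases h03' with h' | h'
    all_goals
      obtain ⟨l, k, hm, hlk, hlj, hik⟩ := h.exists_quadVec h'
      have P := h.plucker_five hm
      clear hm
      fin_cases l <;> fin_cases k <;> simp [quadVec] at P hlk hlj hik <;> grind only
  · clear h03'
    rcases h04' with h' | h'
    all_goals
      obtain ⟨l, k, hm, hlk, hlj, hik⟩ := h.exists_quadVec h'
      have P := h.plucker_five hm
      clear hm
      fin_cases l <;> fin_cases k <;> simp [quadVec] at P hlk hlj hik <;> grind only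
  · clear h04'
    rcases h03' with h' | h'
    all_goals
      obtain ⟨l, k, hm, hlk, hlj, hik⟩ := h.exists_quadVec h'
      have P := h.plucker_five hm
      clear hm
      fin_cases l <;> fin_cases k <;> simp [quadVec] at P hlk hlj hik <;> grind only

theorem eq_closure_pair {n : ℕ} {Λ : AddSubgroup (Fin n → ℤ)} {s t : Fin n → ℤ} (hs : s ∈ Λ)
    (ht : t ∈ Λ) (h : ∀ v ∈ Λ, ∃ a b : ℤ, ∀ x, v x = a * s x + b * t x) :
    Λ = AddSubgroup.closure {s, t} := by
  apply le_antisymm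
  · intro v hv
    obtain ⟨a, b, hab⟩ := h v hv
    exact AddSubgroup.mem_closure_pair.2 ⟨a, b, by ext x; simp [hab]⟩
  · rw [AddSubgroup.closure_le]
    rintro _ (rfl | rfl) <;> assumption

theorem _root_.IsTableLattice.isTableUpToPerm {n : ℕ} {Λ : AddSubgroup (Fin n → ℤ)}
    (h : IsTableLattice Λ) : IsTableUpToPerm Λ :=
  ⟨1, by rwa [show permMap (1 : Equiv.Perm (Fin n)) = AddMonoidHom.id _ from rfl,
    AddSubgroup.map_id]⟩

theorem false_of_combination {n : ℕ} {Λ : AddSubgroup (Fin n → ℤ)} {D : Fin n → Fin n → ℤ}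
    (h : PartnerConfig Λ D) {s t v : Fin n → ℤ} (hs : s ∈ Λ) (ht : t ∈ Λ) (hv : v ∈ Λ)
    {i j : Fin n} (hij : i ≠ j) (a b : ℤ)
    (hx : ∀ x, v x + a * s x + b * t x = (if x = i then 1 else 0) - (if x = j then 1 else 0)) :
    False := by
  refine h.sub_notMem i j hij ?_
  convert Λ.add_mem (Λ.add_mem hv (Λ.zsmul_mem hs a)) (Λ.zsmul_mem ht b) using 1
  ext x
  simpa [Pi.single_apply] using (hx x).symm

theorem quadVec_swap_mem {n : ℕ} {Λ : AddSubgroup (Fin n → ℤ)} {i j l k : Fin n}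
    (h : quadVec i j l k ∈ Λ) : quadVec j i k l ∈ Λ := by
  convert Λ.neg_mem h using 1
  ext x
  simp only [quadVec, Pi.neg_apply]
  ring

theorem isTableLattice_three {Λ : AddSubgroup (Fin 3 → ℤ)} {D : Fin 3 → Fin 3 → ℤ}
    (h : PartnerConfig Λ D) (h01 : 0 < D 0 1) : IsTableLattice Λ := by
  have r := fun i => h.row_sum i
  simp only [Fin.sum_univ_three] at r
  have r0 := r 0
  have r1 := r 1
  have a := h.antisymm
  have a1 := a 0 0
  have a2 := a 1 1
  have a3 := a 2 2
  have a4 := a 0 1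
  have a5 := a 0 2
  have a6 := a 1 2
  have key : ∀ i j, 0 < D i j → quadVec i j i j ∈ Λ := by
    intro i j hij
    obtain ⟨l, k, hm, hlk, hlj, hik⟩ := h.exists_quadVec hij
    have p := h.plucker _ hm 0 1 2
    fin_cases i <;> fin_cases j <;> fin_cases l <;> fin_cases k <;>
      simp [quadVec] at hij hlk hlj hik p <;> omega
  have hs := key 0 1 h01
  have ht := quadVec_swap_mem (key 2 0 (by omega))
  rw [show quadVec 0 1 0 1 = (tVec [2, -2, 0] : Fin 3 → ℤ) by decide] at hs
  rw [show quadVec 0 2 0 2 = (tVec [2, 0, -2] : Fin 3 → ℤ) by decide] at ht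
  refine Or.inr (Or.inr (Or.inr (Or.inl ⟨rfl, eq_closure_pair hs ht fun v hv => ?_⟩)))
  have h0 := h.sum_eq_zero v hv
  simp only [Fin.sum_univ_three] at h0
  have h1 : v 1 % 2 = 0 := by
    by_contra h1
    rcases Int.emod_two_eq_zero_or_one (v 2) with h2 | h2
    · refine h.false_of_combination hs ht hv (i := 0) (j := 1) (by decide) ((v 1 + 1) / 2)
        (v 2 / 2) fun x => ?_
      fin_cases x <;> simp [tVec] <;> omega
    · refine h.false_of_combination hs ht hv (i := 1) (j := 2) (by decide) ((v 1 - 1) / 2)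
        ((v 2 + 1) / 2) fun x => ?_
      fin_cases x <;> simp [tVec] <;> omega
  have h2 : v 2 % 2 = 0 := by
    by_contra h2
    refine h.false_of_combination hs ht hv (i := 0) (j := 2) (by decide) (v 1 / 2)
      ((v 2 + 1) / 2) fun x => ?_
    fin_cases x <;> simp [tVec] <;> omega
  refine ⟨-(v 1 / 2), -(v 2 / 2), fun x => ?_⟩
  fin_cases x <;> simp [tVec] <;> omega

theorem isTableUpToPerm_three {Λ : AddSubgroup (Fin 3 → ℤ)} {D : Fin 3 → Fin 3 → ℤ}
    (h : PartnerConfig Λ D) : IsTableUpToPerm Λ := by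
  obtain ⟨j, hj⟩ := h.exists_ne 0
  have h0 := h.antisymm 0 j
  have hj0 : 0 ≠ j := by rintro rfl; omega
  obtain ⟨x, y, hxy, hD⟩ : ∃ x y, x ≠ y ∧ 0 < D x y := by
    rcases lt_or_gt_of_ne hj with hj | hj
    · exact ⟨j, 0, hj0.symm, by omega⟩
    · exact ⟨0, j, hj0, hj⟩
  obtain ⟨σ, hσ⟩ := exists_perm_extend (m := 2) (n := 3) (by decide) (f := ![x, y]) (by
    simpa [Function.Injective, Fin.forall_fin_two, eq_comm] using hxy)
  have h0 : σ 0 = x := hσ 0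
  have h1 : σ 1 = y := hσ 1
  exact ((h.permute σ).isTableLattice_three (by simpa [h0, h1] using hD)).isTableUpToPerm.of_map

theorem isTableLattice_four {Λ : AddSubgroup (Fin 4 → ℤ)} {D : Fin 4 → Fin 4 → ℤ}
    (h : PartnerConfig Λ D) (h23 : D 2 3 = 0) (hs : quadVec 0 1 0 1 ∈ Λ)
    (ht : quadVec 0 2 0 3 ∈ Λ) : IsTableLattice Λ := by
  have h02 : D 0 2 ≠ 0 := by
    intro h02
    have P := h.plucker_four ht
    have Q := h.plucker_four hs
    simp [quadVec, h02, h23] at P Q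
    obtain ⟨j, hj⟩ := h.exists_ne 0
    have := h.anti_four
    have := h.row_four
    fin_cases j <;> simp at hj <;> omega
  rw [show quadVec 0 1 0 1 = (tVec [2, -2, 0, 0] : Fin 4 → ℤ) by decide] at hs
  rw [show quadVec 0 2 0 3 = (tVec [2, 0, -1, -1] : Fin 4 → ℤ) by decide] at ht
  refine Or.inr (Or.inr (Or.inl ⟨rfl, eq_closure_pair hs ht fun v hv => ?_⟩))
  have h0 := h.sum_eq_zero v hv
  simp only [Fin.sum_univ_four] at h0
  have hv3 : v 3 = v 2 := by
    have P := (h.plucker_four ht).2.2.1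
    have Q := (h.plucker_four hv).2.2.1
    simp [tVec, h23] at P Q
    apply mul_right_cancel₀ h02
    linear_combination Q + v 2 * P
  have h1 : v 1 % 2 = 0 := by
    by_contra h1
    refine h.false_of_combination hs ht hv (i := 0) (j := 1) (by decide) ((v 1 + 1) / 2)
      (v 2) fun x => ?_
    fin_cases x <;> simp [tVec] <;> omega
  refine ⟨-(v 1 / 2), -v 2, fun x => ?_⟩
  fin_cases x <;> simp [tVec] <;> omega

theorem isTableUpToPerm_four_of_pos {Λ : AddSubgroup (Fin 4 → ℤ)} {D : Fin 4 → Fin 4 → ℤ}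
    (h : PartnerConfig Λ D) (h01 : D 0 1 = 0) (h02 : 0 < D 0 2) : IsTableUpToPerm Λ := by
  obtain ⟨hs, ht⟩ := h.four_parallel h01 h02
  obtain ⟨σ, hσ⟩ := exists_perm_extend (m := 4) (n := 4) le_rfl (f := ![2, 3, 0, 1]) (by decide)
  have h0 : σ 0 = 2 := hσ 0
  have h1 : σ 1 = 3 := hσ 1
  have h2 : σ 2 = 0 := hσ 2
  have h3 : σ 3 = 1 := hσ 3
  refine ((h.permute σ).isTableLattice_four (by simpa [h2, h3] using h01) ⟨_, hs, ?_⟩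
    ⟨_, quadVec_swap_mem ht, ?_⟩).isTableUpToPerm.of_map
  all_goals
    ext x
    fin_cases x <;> simp [permMap, quadVec, h0, h1, h2, h3]

theorem isTableUpToPerm_four_of_parallel {Λ : AddSubgroup (Fin 4 → ℤ)} {D : Fin 4 → Fin 4 → ℤ}
    (h : PartnerConfig Λ D) (h01 : D 0 1 = 0) : IsTableUpToPerm Λ := by
  have h02 : D 0 2 ≠ 0 := by
    intro h02
    obtain ⟨j, hj⟩ := h.exists_ne 0
    have := h.anti_four
    have := h.row_four
    fin_cases j <;> simp at hj <;> omega
  rcases lt_or_gt_of_ne h02 with h02 | h02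
  · have h03 : 0 < D 0 3 := by linarith [h.row_four.1]
    exact ((h.permute (Equiv.swap 2 3)).isTableUpToPerm_four_of_pos h01 h03).of_map
  · exact h.isTableUpToPerm_four_of_pos h01 h02

theorem four_false_of_injective {Λ : AddSubgroup (Fin 4 → ℤ)} {D : Fin 4 → Fin 4 → ℤ}
    (h : PartnerConfig Λ D) (h0 : ∀ i j, i ≠ j → D i j ≠ 0) {a b c : Fin 4} (hab : 0 < D a b)
    (hac : 0 < D a c) (hbc : b ≠ c) : False := by
  have ha := h.antisymm a a
  have hb : a ≠ b := by rintro rfl; omega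
  have hc : a ≠ c := by rintro rfl; omega
  wlog hD : 0 < D b c generalizing b c
  · refine this hac hab hbc.symm hc hb ?_
    have := h.antisymm b c
    have := h0 b c hbc
    omega
  obtain ⟨σ, hσ⟩ := exists_perm_extend (m := 3) (n := 4) (by decide) (f := ![a, b, c]) (by
    simp [Function.Injective, Fin.forall_fin_succ, hb, hc, hbc, hb.symm, hc.symm, hbc.symm])
  have e0 : σ 0 = a := hσ 0
  have e1 : σ 1 = b := hσ 1
  have e2 : σ 2 = c := hσ 2
  refine (h.permute σ).four_false_of_pos (by simpa [e0, e1]) (by simpa [e0, e2])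
    (by simpa [e1, e2]) (h0 _ _ (by simp))

theorem isTableUpToPerm_four {Λ : AddSubgroup (Fin 4 → ℤ)} {D : Fin 4 → Fin 4 → ℤ}
    (h : PartnerConfig Λ D) : IsTableUpToPerm Λ := by
  by_cases h0 : ∀ i j, i ≠ j → D i j ≠ 0
  · exfalso
    have h01 := h0 0 1 (by decide)
    have h02 := h0 0 2 (by decide)
    have h03 := h0 0 3 (by decide)
    have a := h.anti_four
    have r := h.row_four
    have F := fun a b c => h.four_false_of_injective h0 (a := a) (b := b) (c := c)
    have h12 := h0 1 2 (by decide)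
    have h23 := h0 2 3 (by decide)
    rcases lt_or_gt_of_ne h01 with h01 | h01 <;> rcases lt_or_gt_of_ne h02 with h02 | h02 <;>
      rcases lt_or_gt_of_ne h03 with h03 | h03 <;> rcases lt_or_gt_of_ne h12 with h12 | h12 <;>
      rcases lt_or_gt_of_ne h23 with h23 | h23
    all_goals first
      | omega
      | exact F 0 1 2 (by omega) (by omega) (by decide)
      | exact F 0 1 3 (by omega) (by omega) (by decide)
      | exact F 0 2 3 (by omega) (by omega) (by decide)
      | exact F 1 0 2 (by omega) (by omega) (by decide)
      | exact F 2 0 1 (by omega) (by omega) (by decide)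
      | exact F 2 0 3 (by omega) (by omega) (by decide)
      | exact F 2 1 3 (by omega) (by omega) (by decide)
      | exact F 3 0 2 (by omega) (by omega) (by decide)
  · push Not at h0
    obtain ⟨i, j, hij, h0⟩ := h0
    obtain ⟨σ, hσ⟩ := exists_perm_extend (m := 2) (n := 4) (by decide) (f := ![i, j]) (by
      simpa [Function.Injective, Fin.forall_fin_two, eq_comm] using hij)
    have e0 : σ 0 = i := hσ 0
    have e1 : σ 1 = j := hσ 1
    exact ((h.permute σ).isTableUpToPerm_four_of_parallel (by simpa [e0, e1] using h0)).of_map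

set_option maxHeartbeats 4000000 in
theorem isTableLattice_five {Λ : AddSubgroup (Fin 5 → ℤ)} {D : Fin 5 → Fin 5 → ℤ}
    (h : PartnerConfig Λ D) (h12 : D 1 2 = 0) (h34 : D 3 4 = 0) (h01 : D 0 1 ≠ 0)
    (h03 : D 0 3 ≠ 0) (h13 : D 1 3 ≠ 0) : IsTableLattice Λ := by
  obtain ⟨r0, r1, r2, r3, r4⟩ := h.row_five
  obtain ⟨a0, a1, a2, a3, a4, a5, a6, a7, a8, a9, a10, a11, a12, a13, a14⟩ := h.anti_five
  have h02 : D 0 2 ≠ 0 := fun h02 => h01 (h.parallel_trans 0 2 1 h02 (by omega))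
  have h04 : D 0 4 ≠ 0 := fun h04 => h03 (h.parallel_trans 0 4 3 h04 (by omega))
  have h14 : D 1 4 ≠ 0 := fun h14 => h13 (h.parallel_trans 1 4 3 h14 (by omega))
  have h23 : D 2 3 ≠ 0 := fun h23 => h13 (h.parallel_trans 1 2 3 h12 h23)
  have h24 : D 2 4 ≠ 0 := fun h24 => h14 (h.parallel_trans 1 2 4 h12 h24)
  have hs : quadVec 0 1 0 2 ∈ Λ := by
    have h01' : 0 < D 0 1 ∨ 0 < D 1 0 := by omega
    rcases h01' with h' | h'
    all_goals
      obtain ⟨l, k, hm, hlk, hlj, hik⟩ := h.exists_quadVec h'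
      have P := h.plucker_five hm
      fin_cases l <;> fin_cases k <;> simp [quadVec] at P hlk hlj hik <;>
        first | grind only | exact hm | exact quadVec_swap_mem hm
  have ht : quadVec 0 3 0 4 ∈ Λ := by
    have h03' : 0 < D 0 3 ∨ 0 < D 3 0 := by omega
    rcases h03' with h' | h'
    all_goals
      obtain ⟨l, k, hm, hlk, hlj, hik⟩ := h.exists_quadVec h'
      have P := h.plucker_five hm
      fin_cases l <;> fin_cases k <;> simp [quadVec] at P hlk hlj hik <;>
        first | grind only | exact hm | exact quadVec_swap_mem hm
  have Ps := h.plucker_five hs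
  have Pt := h.plucker_five ht
  simp [quadVec] at Ps Pt
  rw [show quadVec 0 1 0 2 = (tVec [2, -1, -1, 0, 0] : Fin 5 → ℤ) by decide] at hs
  rw [show quadVec 0 3 0 4 = (tVec [2, 0, 0, -1, -1] : Fin 5 → ℤ) by decide] at ht
  refine Or.inr (Or.inl ⟨rfl, eq_closure_pair hs ht fun v hv => ?_⟩)
  have hv0 := h.sum_eq_zero v hv
  simp only [Fin.sum_univ_five] at hv0
  have Pv := h.plucker_five hv
  have hv2 : v 2 = v 1 := by
    have : D 0 1 = D 0 2 := by omega
    have hP := Pv.1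
    rw [h12, this] at hP
    apply mul_right_cancel₀ h02
    linear_combination hP
  have hv4 : v 4 = v 3 := by
    have : D 0 3 = D 0 4 := by omega
    have hP := Pv.2.2.2.2.2.1
    rw [h34, this] at hP
    apply mul_right_cancel₀ h04
    linear_combination hP
  refine ⟨-v 1, -v 3, fun x => ?_⟩
  fin_cases x <;> simp [tVec] <;> omega

theorem five_false_of_triple {Λ : AddSubgroup (Fin 5 → ℤ)} {D : Fin 5 → Fin 5 → ℤ}
    (h : PartnerConfig Λ D) (h01 : D 0 1 = 0) (h02 : D 0 2 = 0) : False := by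
  have r := h.row_five.1
  have h03 : D 0 3 ≠ 0 := by
    intro h03
    obtain ⟨j, hj⟩ := h.exists_ne 0
    have := h.anti_five.1
    fin_cases j <;> simp at hj <;> omega
  rcases lt_or_gt_of_ne h03 with h03 | h03
  · exact (h.permute (Equiv.swap 3 4)).five_triple h01 h02 (by change 0 < D 0 4; omega)
  · exact h.five_triple h01 h02 h03

theorem isTableUpToPerm_five_of_two_pairs {Λ : AddSubgroup (Fin 5 → ℤ)} {D : Fin 5 → Fin 5 → ℤ}
    (h : PartnerConfig Λ D) (h01 : D 0 1 = 0) (h23 : D 2 3 = 0) : IsTableUpToPerm Λ := by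
  have h02 : D 0 2 ≠ 0 := fun h02 => h.five_false_of_triple h01 h02
  have h04 : D 0 4 ≠ 0 := fun h04 => (h.permute (Equiv.swap 2 4)).five_false_of_triple h01 h04
  have h24 : D 2 4 ≠ 0 := by
    intro h24
    obtain ⟨σ, hσ⟩ := exists_perm_extend (m := 3) (n := 5) (by decide) (f := ![2, 3, 4])
      (by decide)
    have e0 : σ 0 = 2 := hσ 0
    have e1 : σ 1 = 3 := hσ 1
    have e2 : σ 2 = 4 := hσ 2
    exact (h.permute σ).five_false_of_triple (by simpa [e0, e1] using h23)
      (by simpa [e0, e2] using h24)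
  obtain ⟨σ, hσ⟩ := exists_perm_extend (m := 5) (n := 5) le_rfl (f := ![4, 0, 1, 2, 3])
    (by decide)
  have e0 : σ 0 = 4 := hσ 0
  have e1 : σ 1 = 0 := hσ 1
  have e2 : σ 2 = 1 := hσ 2
  have e3 : σ 3 = 2 := hσ 3
  have e4 : σ 4 = 3 := hσ 4
  refine ((h.permute σ).isTableLattice_five ?_ ?_ ?_ ?_ ?_).isTableUpToPerm.of_map
  · simpa [e1, e2] using h01
  · simpa [e3, e4] using h23
  · simpa [e0, e1, h.antisymm 0 4] using h04
  · simpa [e0, e3, h.antisymm 2 4] using h24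
  · simpa [e1, e3] using h02

theorem isTableUpToPerm_five_of_parallel {Λ : AddSubgroup (Fin 5 → ℤ)} {D : Fin 5 → Fin 5 → ℤ}
    (h : PartnerConfig Λ D) (h01 : D 0 1 = 0) : IsTableUpToPerm Λ := by
  by_cases h23 : D 2 3 = 0
  · exact h.isTableUpToPerm_five_of_two_pairs h01 h23
  by_cases h24 : D 2 4 = 0
  · exact ((h.permute (Equiv.swap 3 4)).isTableUpToPerm_five_of_two_pairs h01 h24).of_map
  by_cases h34 : D 3 4 = 0
  · exact ((h.permute (Equiv.swap 2 3 * Equiv.swap 3 4)).isTableUpToPerm_five_of_two_pairs h01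
      h34).of_map
  exfalso
  have h02 : D 0 2 ≠ 0 := fun h02 => h.five_false_of_triple h01 h02
  have h03 : D 0 3 ≠ 0 := fun h03 => (h.permute (Equiv.swap 2 3)).five_false_of_triple h01 h03
  have h04 : D 0 4 ≠ 0 := fun h04 => (h.permute (Equiv.swap 2 4)).five_false_of_triple h01 h04
  have r := h.row_five.1
  obtain h' | h' | h' : 0 < D 0 2 ∨ 0 < D 0 3 ∨ 0 < D 0 4 := by omega
  · exact h.five_pair h01 h' h03 h04 h23 h24 h34
  · refine (h.permute (Equiv.swap 2 3)).five_pair h01 h' h02 h04 ?_ h34 h24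
    rw [h.antisymm, neg_ne_zero]
    exact h23
  · refine (h.permute (Equiv.swap 2 4)).five_pair h01 h' h03 h02 ?_ ?_ ?_
    · rw [h.antisymm, neg_ne_zero]
      exact h34
    · rw [h.antisymm, neg_ne_zero]
      exact h24
    · rw [h.antisymm, neg_ne_zero]
      exact h23

theorem eq_zero_of_parallel {n : ℕ} {Λ : AddSubgroup (Fin n → ℤ)} {D : Fin n → Fin n → ℤ}
    (h : PartnerConfig Λ D) {v : Fin n → ℤ} (hv : v ∈ Λ) {x y : Fin n} (hxy : D x y = 0)
    (hx : v x = 0) : v y = 0 := by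
  obtain ⟨m, hm⟩ := h.exists_ne x
  have p := h.plucker v hv x y m
  rw [h.antisymm x m, hxy, hx] at p
  simpa [hm] using p

theorem parallel_of_eq_zero {n : ℕ} {Λ : AddSubgroup (Fin n → ℤ)} {D : Fin n → Fin n → ℤ}
    (h : PartnerConfig Λ D) {v : Fin n → ℤ} (hv : v ∈ Λ) {x y z : Fin n} (hx : v x = 0)
    (hy : v y = 0) (hz : v z ≠ 0) : D x y = 0 := by
  have p := h.plucker v hv x y z
  simpa [hx, hy, hz] using p

theorem isTableUpToPerm_five {Λ : AddSubgroup (Fin 5 → ℤ)} {D : Fin 5 → Fin 5 → ℤ}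
    (h : PartnerConfig Λ D) : IsTableUpToPerm Λ := by
  by_cases h0 : ∀ i j, i ≠ j → D i j ≠ 0
  · exfalso
    obtain ⟨i, j, hij⟩ : ∃ i j, 0 < D i j := by
      rcases lt_or_gt_of_ne (h0 0 1 (by decide)) with h01 | h01
      · exact ⟨1, 0, by rw [h.antisymm]; omega⟩
      · exact ⟨0, 1, h01⟩
    have hii := h.antisymm i i
    have hne : i ≠ j := by rintro rfl; omega
    obtain ⟨l, k, hm, hlk, hlj, hik⟩ := h.exists_quadVec hij
    have hll := h.antisymm l l
    have hne' : l ≠ k := by rintro rfl; omega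
    have hi : quadVec i j l k i ≠ 0 := by
      simp only [quadVec, hne, hik, if_true, if_false]
      split_ifs <;> decide
    have hz : ∀ x y, quadVec i j l k x = 0 → quadVec i j l k y = 0 → x = y := by
      intro x y hx hy
      by_contra hxy
      exact h0 x y hxy (h.parallel_of_eq_zero hm hx hy hi)
    have key : i ≠ l ∧ j ≠ k := by
      clear hm hi hlk hij hii hll h h0
      revert hz
      revert i j l k
      decide
    obtain ⟨σ, hσ⟩ := exists_perm_extend (m := 4) (n := 5) (by decide) (f := ![i, j, l, k]) (by
      simp [Function.Injective, Fin.forall_fin_succ, hne, hne.symm, hne', hne'.symm, hlj, hlj.symm,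
        hik, hik.symm, key.1, key.1.symm, key.2, key.2.symm])
    have e0 : σ 0 = i := hσ 0
    have e1 : σ 1 = j := hσ 1
    have e2 : σ 2 = l := hσ 2
    have e3 : σ 3 = k := hσ 3
    refine (h.permute σ).five_nonparallel (fun x y hxy => h0 _ _ (by simpa using hxy))
      ⟨_, hm, ?_⟩
    ext x
    simp [permMap, quadVec, ← e0, ← e1, ← e2, ← e3]
  · push Not at h0
    obtain ⟨i, j, hij, h0⟩ := h0
    obtain ⟨σ, hσ⟩ := exists_perm_extend (m := 2) (n := 5) (by decide) (f := ![i, j]) (by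
      simpa [Function.Injective, Fin.forall_fin_two, eq_comm] using hij)
    have e0 : σ 0 = i := hσ 0
    have e1 : σ 1 = j := hσ 1
    exact ((h.permute σ).isTableUpToPerm_five_of_parallel (by simpa [e0, e1] using h0)).of_map

theorem quadVec_left_ne_zero {n : ℕ} {i j l k : Fin n} (hij : i ≠ j) (hik : i ≠ k) :
    quadVec i j l k i ≠ 0 := by
  simp only [quadVec, hij, hik, if_true, if_false]
  split_ifs <;> decide

theorem quadVec_right_ne_zero {n : ℕ} {i j l k : Fin n} (hij : i ≠ j) (hlj : l ≠ j) :
    quadVec i j l k j ≠ 0 := by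
  simp only [quadVec, hij.symm, hlj.symm, if_true, if_false]
  split_ifs <;> decide

theorem quadVec_mem_of_parallel {n : ℕ} {Λ : AddSubgroup (Fin n → ℤ)} {D : Fin n → Fin n → ℤ}
    (h : PartnerConfig Λ D) {i i' j j' : Fin n} (hi : i ≠ i') (hj : j ≠ j') (hii : D i i' = 0)
    (hjj : D j j' = 0) (hij : D i j ≠ 0) : quadVec i j i' j' ∈ Λ := by
  wlog hD : 0 < D i j generalizing i i' j j'
  · have h' := h.antisymm i j
    exact quadVec_swap_mem (this hj hi hjj hii (by omega) (by omega))
  have hsymm : ∀ {a b}, D a b = 0 → D b a = 0 := fun {a b} hab => by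
    rw [h.antisymm, hab, neg_zero]
  have nij : i ≠ j := fun e => hij (by rw [← e]; have := h.antisymm i i; omega)
  have nij' : i ≠ j' := fun e => hij (hsymm (e ▸ hjj))
  have ni'j : i' ≠ j := fun e => hij (e ▸ hii)
  have ni'j' : i' ≠ j' := fun e => hij (h.parallel_trans _ _ _ (e ▸ hii) (hsymm hjj))
  obtain ⟨l, k, hm, hlk, hlj, hik⟩ := h.exists_quadVec hD
  have hi' : quadVec i j l k i' ≠ 0 := fun h' =>
    quadVec_left_ne_zero nij hik (h.eq_zero_of_parallel hm (hsymm hii) h')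
  have hj' : quadVec i j l k j' ≠ 0 := fun h' =>
    quadVec_right_ne_zero nij hlj (h.eq_zero_of_parallel hm (hsymm hjj) h')
  have hl : i' = l ∨ i' = k := by
    by_contra! hc
    simp [quadVec, hi.symm, ni'j, hc] at hi'
  have hk : j' = l ∨ j' = k := by
    by_contra! hc
    simp [quadVec, nij'.symm, hj.symm, hc] at hj'
  rcases hl with rfl | rfl
  · rcases hk with rfl | rfl
    · exact absurd rfl ni'j'
    · exact hm
  · rcases hk with rfl | rfl
    · have p := h.plucker _ hm i i' j
      have q := h.plucker _ hm i j j'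
      simp [quadVec, hi, hi.symm, hj, hj.symm, nij, nij.symm, nij', nij'.symm, ni'j, ni'j.symm,
        ni'j', ni'j'.symm, hii, hjj] at p q
      have p' := h.plucker _ hm i i' j'
      simp [quadVec, hi, hi.symm, hj.symm, nij, nij', nij'.symm, ni'j, ni'j', ni'j'.symm,
        hii] at p'
      have := h.antisymm i j
      have := h.antisymm i j'
      have := h.antisymm i' j'
      omega
    · exact absurd rfl ni'j'

theorem isTableLattice_six {Λ : AddSubgroup (Fin 6 → ℤ)} {D : Fin 6 → Fin 6 → ℤ}
    (h : PartnerConfig Λ D) (h01 : D 0 1 = 0) (h23 : D 2 3 = 0) (h45 : D 4 5 = 0)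
    (h02 : D 0 2 ≠ 0) (h04 : D 0 4 ≠ 0) : IsTableLattice Λ := by
  have hs : quadVec 0 2 1 3 ∈ Λ :=
    h.quadVec_mem_of_parallel (by decide) (by decide) h01 h23 h02
  have ht : quadVec 0 4 1 5 ∈ Λ :=
    h.quadVec_mem_of_parallel (by decide) (by decide) h01 h45 h04
  have Ps := h.plucker_six hs
  have Pt := h.plucker_six ht
  simp [quadVec, h01, h23, h45] at Ps Pt
  rw [show quadVec 0 2 1 3 = (tVec [1, 1, -1, -1, 0, 0] : Fin 6 → ℤ) by decide] at hs
  rw [show quadVec 0 4 1 5 = (tVec [1, 1, 0, 0, -1, -1] : Fin 6 → ℤ) by decide] at ht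
  refine Or.inl ⟨rfl, eq_closure_pair hs ht fun v hv => ?_⟩
  have hv0 := h.sum_eq_zero v hv
  simp only [Fin.sum_univ_six] at hv0
  obtain ⟨p012, -, -, -, p023, -, -, -, -, p045, -⟩ := h.plucker_six hv
  rw [h01] at p012
  rw [h23] at p023
  rw [h45] at p045
  have hv1 : v 1 = v 0 := by
    have : D 1 2 = D 0 2 := by omega
    rw [this] at p012
    apply mul_right_cancel₀ h02
    linear_combination -p012
  have hv3 : v 3 = v 2 := by
    have : D 0 3 = D 0 2 := by omega
    rw [this] at p023
    apply mul_right_cancel₀ h02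
    linear_combination p023
  have hv5 : v 5 = v 4 := by
    have : D 0 5 = D 0 4 := by omega
    rw [this] at p045
    apply mul_right_cancel₀ h04
    linear_combination p045
  refine ⟨-v 2, -v 4, fun x => ?_⟩
  fin_cases x <;> simp [tVec] <;> omega

/-- The indices whose columns are parallel to that of `x`. -/
def parallelClass {n : ℕ} (D : Fin n → Fin n → ℤ) (x : Fin n) : Finset (Fin n) := {y | D x y = 0}

theorem exists_support {n : ℕ} {Λ : AddSubgroup (Fin n → ℤ)} {D : Fin n → Fin n → ℤ}
    (h : PartnerConfig Λ D) {x y : Fin n} (hxy : D x y ≠ 0) :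
    ∃ v ∈ Λ, ∃ S : Finset (Fin n), S.card ≤ 4 ∧ v x ≠ 0 ∧ v y ≠ 0 ∧ ∀ t ∉ S, v t = 0 := by
  wlog hD : 0 < D x y generalizing x y
  · have h' := h.antisymm x y
    obtain ⟨v, hv, S, hS, hx, hy, ht⟩ := this (x := y) (y := x) (by omega) (by omega)
    exact ⟨v, hv, S, hS, hy, hx, ht⟩
  obtain ⟨l, k, hm, hlk, hlj, hik⟩ := h.exists_quadVec hD
  have hne : x ≠ y := by
    rintro rfl
    have := h.antisymm x x
    omega
  refine ⟨_, hm, {x, y, l, k}, Finset.card_le_four, quadVec_left_ne_zero hne hik,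
    quadVec_right_ne_zero hne hlj, fun t ht => ?_⟩
  simp only [Finset.mem_insert, Finset.mem_singleton, not_or] at ht
  simp [quadVec, ht]

theorem exists_large_class {n : ℕ} {Λ : AddSubgroup (Fin n → ℤ)} {D : Fin n → Fin n → ℤ}
    (h : PartnerConfig Λ D) (hn : 5 ≤ n) {x y : Fin n} (hxy : D x y ≠ 0) :
    ∃ z, D x z ≠ 0 ∧ D y z ≠ 0 ∧ n ≤ (parallelClass D z).card + 4 ∧
      (parallelClass D x).card + (parallelClass D y).card ≤ 4 := by
  have hsymm : ∀ {a b}, D a b = 0 → D b a = 0 := fun {a b} hab => by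
    rw [h.antisymm, hab, neg_zero]
  obtain ⟨v, hv, S, hS, hx, hy, ht⟩ := h.exists_support hxy
  have hcard := S.card_add_card_compl
  rw [Fintype.card_fin] at hcard
  obtain ⟨z, hz⟩ : Sᶜ.Nonempty := Finset.card_pos.1 (by omega)
  rw [Finset.mem_compl] at hz
  refine ⟨z, fun h' => hx (h.eq_zero_of_parallel hv (hsymm h') (ht z hz)),
    fun h' => hy (h.eq_zero_of_parallel hv (hsymm h') (ht z hz)), ?_, ?_⟩
  · have : Sᶜ ⊆ parallelClass D z := fun t hts => by
      simpa [parallelClass] using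
        h.parallel_of_eq_zero hv (ht z hz) (ht t (Finset.mem_compl.1 hts)) hx
    have := Finset.card_le_card this
    omega
  · rw [← Finset.card_union_of_disjoint]
    · refine (Finset.card_le_card fun t hts => ?_).trans hS
      by_contra htS
      simp only [parallelClass, Finset.mem_union, Finset.mem_filter, Finset.mem_univ,
        true_and] at hts
      rcases hts with hts | hts
      · exact hx (h.eq_zero_of_parallel hv (hsymm hts) (ht t htS))
      · exact hy (h.eq_zero_of_parallel hv (hsymm hts) (ht t htS))
    · rw [Finset.disjoint_left]
      intro t h1 h2
      simp only [parallelClass, Finset.mem_filter, Finset.mem_univ, true_and] at h1 h2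
      exact hxy (h.parallel_trans _ _ _ h1 (hsymm h2))

theorem false_of_seven_le {n : ℕ} {Λ : AddSubgroup (Fin n → ℤ)} {D : Fin n → Fin n → ℤ}
    (h : PartnerConfig Λ D) (hn : 7 ≤ n) : False := by
  obtain ⟨y, hxy⟩ := h.exists_ne ⟨0, by omega⟩
  obtain ⟨z, hxz, -, hz, -⟩ := h.exists_large_class (by omega) hxy
  obtain ⟨w, -, hzw, hw, -⟩ := h.exists_large_class (by omega) hxz
  obtain ⟨-, -, -, -, h4⟩ := h.exists_large_class (by omega) hzw
  omega

theorem isTableUpToPerm_six {Λ : AddSubgroup (Fin 6 → ℤ)} {D : Fin 6 → Fin 6 → ℤ}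
    (h : PartnerConfig Λ D) : IsTableUpToPerm Λ := by
  have hsymm : ∀ {a b}, D a b = 0 → D b a = 0 := fun {a b} hab => by
    rw [h.antisymm, hab, neg_zero]
  have htwin : ∀ z, 6 ≤ (parallelClass D z).card + 4 → ∃ z', z' ≠ z ∧ D z z' = 0 := by
    intro z hz
    obtain ⟨z', hz', hne⟩ := Finset.exists_mem_ne (s := parallelClass D z) (by omega) z
    exact ⟨z', hne, by simpa [parallelClass] using hz'⟩
  have hne : ∀ {a b c}, D a b ≠ 0 → D a c = 0 → b ≠ c := by
    rintro a b c hab hac rfl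
    exact hab hac
  obtain ⟨y, hxy⟩ := h.exists_ne 0
  obtain ⟨p, hxp, -, hp, -⟩ := h.exists_large_class (by omega) hxy
  obtain ⟨q, -, hpq, hq, -⟩ := h.exists_large_class (by omega) hxp
  obtain ⟨r, hpr, hqr, hr, -⟩ := h.exists_large_class (by omega) hpq
  obtain ⟨p', hp', hpp'⟩ := htwin p hp
  obtain ⟨q', hq', hqq'⟩ := htwin q hq
  obtain ⟨r', hr', hrr'⟩ := htwin r hr
  have self : ∀ a, D a a = 0 := fun a => by have := h.antisymm a a; omega
  have hpq' : D p q' ≠ 0 := fun h' => hpq (h.parallel_trans _ _ _ h' (hsymm hqq'))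
  have hpr' : D p r' ≠ 0 := fun h' => hpr (h.parallel_trans _ _ _ h' (hsymm hrr'))
  have hqr' : D q r' ≠ 0 := fun h' => hqr (h.parallel_trans _ _ _ h' (hsymm hrr'))
  obtain ⟨σ, hσ⟩ := exists_perm_extend (m := 6) (n := 6) le_rfl (f := ![p, p', q, q', r, r']) (by
    simp [Function.Injective, Fin.forall_fin_succ, hp', hp'.symm, hq', hq'.symm, hr', hr'.symm,
      hne hpq (self p), hne hpq hpp', hne hpq' (self p), hne hpq' hpp', hne hpr (self p),
      hne hpr hpp', hne hpr' (self p), hne hpr' hpp', hne hqr (self q), hne hqr hqq',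
      hne hqr' (self q), hne hqr' hqq',
      (hne hpq (self p)).symm, (hne hpq hpp').symm, (hne hpq' (self p)).symm,
      (hne hpq' hpp').symm, (hne hpr (self p)).symm, (hne hpr hpp').symm,
      (hne hpr' (self p)).symm, (hne hpr' hpp').symm, (hne hqr (self q)).symm,
      (hne hqr hqq').symm, (hne hqr' (self q)).symm, (hne hqr' hqq').symm])
  have e0 : σ 0 = p := hσ 0
  have e1 : σ 1 = p' := hσ 1
  have e2 : σ 2 = q := hσ 2
  have e3 : σ 3 = q' := hσ 3
  have e4 : σ 4 = r := hσ 4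
  have e5 : σ 5 = r' := hσ 5
  exact ((h.permute σ).isTableLattice_six (by simpa [e0, e1]) (by simpa [e2, e3])
    (by simpa [e4, e5]) (by simpa [e0, e2])
    (by simpa [e0, e4])).isTableUpToPerm.of_map

theorem isTableUpToPerm : ∀ {n : ℕ} {Λ : AddSubgroup (Fin n → ℤ)} {D : Fin n → Fin n → ℤ},
    PartnerConfig Λ D → 3 ≤ n → IsTableUpToPerm Λ
  | 3, _, _, h, _ => h.isTableUpToPerm_three
  | 4, _, _, h, _ => h.isTableUpToPerm_four
  | 5, _, _, h, _ => h.isTableUpToPerm_five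
  | 6, _, _, h, _ => h.isTableUpToPerm_six
  | _ + 7, _, _, h, _ => (h.false_of_seven_le (by omega)).elim

end PartnerConfig

theorem SecantCondition.of_map {K : Type*} [Field K] {n : ℕ} {Λ : AddSubgroup (Fin n → ℤ)}
    {σ : Equiv.Perm (Fin n)} (hS : SecantCondition K (Λ.map (permMap σ))) :
    SecantCondition K Λ := by
  intro z hz hv
  obtain ⟨a, b, hab, h⟩ := hS (z ∘ σ) (fun i => hz _) (by
    rintro _ ⟨v, hvΛ, rfl⟩
    exact (Equiv.prod_comp σ (fun i => z i ^ v i)).trans (hv v hvΛ))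
  exact ⟨a, b, hab, fun v hvΛ =>
    (Equiv.sum_comp σ (fun i => (a * z i + b * (z i)⁻¹) * (v i : K))).symm.trans
      (h _ ⟨v, hvΛ, rfl⟩)⟩

theorem secantCondition_closure_pair {K : Type*} [Field K] {n : ℕ} {s t : Fin n → ℤ}
    (h : ∀ z : Fin n → K, (∀ i, z i ≠ 0) → ∏ i, z i ^ s i = 1 → ∏ i, z i ^ t i = 1 →
      ∃ c : K, ∑ i, (z i - c * (z i)⁻¹) * (s i : K) = 0 ∧
        ∑ i, (z i - c * (z i)⁻¹) * (t i : K) = 0) :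
    SecantCondition K (AddSubgroup.closure {s, t}) := by
  intro z hz hv
  obtain ⟨c, hs, ht⟩ := h z hz (hv s (AddSubgroup.subset_closure (by simp)))
    (hv t (AddSubgroup.subset_closure (by simp)))
  refine ⟨1, -c, by simp, fun v hv => ?_⟩
  obtain ⟨a, b, rfl⟩ := AddSubgroup.mem_closure_pair.1 hv
  have : ∀ i, (1 * z i + -c * (z i)⁻¹) * (((a • s + b • t) i : ℤ) : K) =
      a * ((z i - c * (z i)⁻¹) * (s i : K)) + b * ((z i - c * (z i)⁻¹) * (t i : K)) := by
    intro i
    simp only [Pi.add_apply, Pi.smul_apply, smul_eq_mul]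
    push_cast
    ring
  simp only [this, Finset.sum_add_distrib, ← Finset.mul_sum, hs, ht, mul_zero, add_zero]

theorem sub_mul_inv_eq_zero {K : Type*} [Field K] {x c : K} (hc : c = x * x) :
    x - c * x⁻¹ = 0 := by
  rw [hc]
  field_simp
  ring

theorem sub_mul_inv_add_sub_mul_inv_eq_zero {K : Type*} [Field K] {x y c : K} (hx : x ≠ 0)
    (hy : y ≠ 0) (hc : c = x * y) : (x - c * x⁻¹) + (y - c * y⁻¹) = 0 := by
  rw [hc]
  field_simp
  ring

theorem IsTableLattice.secantCondition {K : Type*} [Field K] {n : ℕ}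
    {Λ : AddSubgroup (Fin n → ℤ)} (h : IsTableLattice Λ) : SecantCondition K Λ := by
  rcases h with ⟨rfl, rfl⟩ | ⟨rfl, rfl⟩ | ⟨rfl, rfl⟩ | ⟨rfl, rfl⟩ | ⟨rfl, rfl⟩ <;>
    refine secantCondition_closure_pair fun z hz hs ht => ?_
  · have h0 := hz 0
    have h1 := hz 1
    have h2 := hz 2
    have h3 := hz 3
    have h4 := hz 4
    have h5 := hz 5
    simp [tVec, Fin.prod_univ_six] at hs ht
    field_simp at hs ht
    have e1 := sub_mul_inv_add_sub_mul_inv_eq_zero h0 h1 rfl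
    have e2 := sub_mul_inv_add_sub_mul_inv_eq_zero h2 h3 hs
    have e3 := sub_mul_inv_add_sub_mul_inv_eq_zero h4 h5 ht
    refine ⟨z 0 * z 1, ?_, ?_⟩ <;> simp [tVec, Fin.sum_univ_six]
    · linear_combination e1 - e2
    · linear_combination e1 - e3
  · have h0 := hz 0
    have h1 := hz 1
    have h2 := hz 2
    have h3 := hz 3
    have h4 := hz 4
    simp [tVec, Fin.prod_univ_five] at hs ht
    field_simp at hs ht
    have e1 := sub_mul_inv_eq_zero (sq (z 0))
    have e2 := sub_mul_inv_add_sub_mul_inv_eq_zero h1 h2 hs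
    have e3 := sub_mul_inv_add_sub_mul_inv_eq_zero h3 h4 ht
    refine ⟨z 0 ^ 2, ?_, ?_⟩ <;> simp [tVec, Fin.sum_univ_five]
    · linear_combination 2 * e1 - e2
    · linear_combination 2 * e1 - e3
  · have h0 := hz 0
    have h1 := hz 1
    have h2 := hz 2
    have h3 := hz 3
    simp [tVec, Fin.prod_univ_four] at hs ht
    field_simp at hs ht
    have e1 := sub_mul_inv_eq_zero (sq (z 0))
    have e2 := sub_mul_inv_eq_zero (hs.trans (sq (z 1)))
    have e3 := sub_mul_inv_add_sub_mul_inv_eq_zero h2 h3 ht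
    refine ⟨z 0 ^ 2, ?_, ?_⟩ <;> simp [tVec, Fin.sum_univ_four]
    · linear_combination 2 * e1 - 2 * e2
    · linear_combination 2 * e1 - e3
  · have h0 := hz 0
    have h1 := hz 1
    have h2 := hz 2
    simp [tVec, Fin.prod_univ_three] at hs ht
    field_simp at hs ht
    have e1 := sub_mul_inv_eq_zero (sq (z 0))
    have e2 := sub_mul_inv_eq_zero (hs.trans (sq (z 1)))
    have e3 := sub_mul_inv_eq_zero (ht.trans (sq (z 2)))
    refine ⟨z 0 ^ 2, ?_, ?_⟩ <;> simp [tVec, Fin.sum_univ_three]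
    · linear_combination 2 * e1 - 2 * e2
    · linear_combination 2 * e1 - 2 * e3
  · have h0 := hz 0
    have h1 := hz 1
    have h2 := hz 2
    simp [tVec, Fin.prod_univ_three] at hs ht
    field_simp at hs ht
    have e1 := sub_mul_inv_eq_zero (sq (z 0))
    have e2 := sub_mul_inv_eq_zero (hs.trans (sq (z 1)))
    have e3 := sub_mul_inv_add_sub_mul_inv_eq_zero h1 h2 ht
    refine ⟨z 0 ^ 2, ?_, ?_⟩ <;> simp [tVec, Fin.sum_univ_three]
    · linear_combination 2 * e1 - 2 * e2
    · linear_combination 2 * e1 - e3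

theorem sum_eq_zero_of_mem_latticeOf {n d : ℕ} {B : Set (Fin n → ℤ)} (hB : B ⊆ Delta n d)
    {v : Fin n → ℤ} (hv : v ∈ latticeOf B) : ∑ i, v i = 0 := by
  induction hv using AddSubgroup.closure_induction with
  | mem x hx =>
    obtain ⟨v, hv, w, hw, rfl⟩ := hx
    simp [Finset.sum_sub_distrib, (hB hv).2, (hB hw).2]
  | zero => simp
  | add x y _ _ hx hy => simp [Finset.sum_add_distrib, hx, hy]
  | neg x _ hx => simp [hx]

theorem exists_mem_latticeOf_ne_zero {n : ℕ} {B : Set (Fin n → ℤ)} (hbpf : Basepointfree B)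
    (hconc : Concise B) (i : Fin n) : ∃ v ∈ latticeOf B, v i ≠ 0 := by
  obtain ⟨v, hv, hvi⟩ := hconc i
  obtain ⟨w, hw, hwi⟩ := hbpf i
  exact ⟨v - w, AddSubgroup.subset_closure ⟨v, hv, w, hw, rfl⟩, by simpa [hwi] using hvi⟩

theorem statement_13 (K : Type*) [Field K] [IsAlgClosed K] [CharZero K]
    (d ℓ : ℕ) (hd : 1 ≤ d) (hl : 2 ≤ ℓ)
    (B : Set (Fin (ℓ + 1) → ℤ))
    (hBΔ : B ⊆ Delta (ℓ + 1) d)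
    (hbpf : Basepointfree B)
    (hconc : Concise B)
    (hrank : Module.finrank ℤ (AddSubgroup.toIntSubmodule (latticeOf B)) = 2)
    (hne : ∀ i j : Fin (ℓ + 1), i ≠ j →
      (Pi.single i 1 - Pi.single j 1 : Fin (ℓ + 1) → ℤ) ∉ latticeOf B) :
    SecantCondition K (latticeOf B) ↔
      ∃ σ : Equiv.Perm (Fin (ℓ + 1)),
        IsTableLattice ((latticeOf B).map (permMap σ)) := by
  constructor
  · intro hS
    obtain ⟨D, hD⟩ := exists_partnerConfig hS hrank hne
      (fun v hv => sum_eq_zero_of_mem_latticeOf hBΔ hv) (exists_mem_latticeOf_ne_zero hbpf hconc)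
    exact hD.isTableUpToPerm (by omega)
  · rintro ⟨σ, h⟩
    exact h.secantCondition.of_map
end

section
/- Let k be a field, n a natural number, and let I ⊆ k[x_1,…,x_n] be an ideal generated by a set of binomials, i.e., by polynomials of the form x^a − x^b with a, b ∈ ℕ^n. If f ∈ I and the monomial x^v appears in f with nonzero coefficient, then there exists v′ ∈ ℕ^n with v′ ≠ v such that x^{v′} appears in f with nonzero coefficient and x^v − x^{v′} ∈ I. -/
open scoped Classical in
/-- The linear functional summing the coefficients of a polynomial over all exponents `a` with
`x^v - x^a ∈ I`. -/
noncomputable def monomialClassSum {σ R : Type*} [CommRing R] (I : Ideal (MvPolynomial σ R))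
    (v : σ →₀ ℕ) : MvPolynomial σ R →ₗ[R] R :=
  (MvPolynomial.basisMonomials σ R).constr R fun a =>
    if MvPolynomial.monomial v 1 - MvPolynomial.monomial a 1 ∈ I then 1 else 0

open scoped Classical in
theorem monomialClassSum_monomial {σ R : Type*} [CommRing R] (I : Ideal (MvPolynomial σ R))
    (v a : σ →₀ ℕ) (r : R) :
    monomialClassSum I v (MvPolynomial.monomial a r) =
      if MvPolynomial.monomial v 1 - MvPolynomial.monomial a 1 ∈ I then r else 0 := by
  have h : monomialClassSum I v (MvPolynomial.monomial a 1) =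
      if MvPolynomial.monomial v 1 - MvPolynomial.monomial a 1 ∈ I then 1 else 0 := by
    simpa only [monomialClassSum, MvPolynomial.coe_basisMonomials] using
      (MvPolynomial.basisMonomials σ R).constr_basis R _ a
  have hr : MvPolynomial.monomial a r = r • MvPolynomial.monomial a (1 : R) := by
    rw [MvPolynomial.smul_monomial, smul_eq_mul, mul_one]
  rw [hr, map_smul, h]
  split_ifs <;> simp

theorem monomialClassSum_mul_eq_zero {σ R : Type*} [CommRing R] {I : Ideal (MvPolynomial σ R)}
    (v : σ →₀ ℕ) {a b : σ →₀ ℕ}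
    (h : MvPolynomial.monomial a 1 - MvPolynomial.monomial b 1 ∈ I) (g : MvPolynomial σ R) :
    monomialClassSum I v (g * (MvPolynomial.monomial a 1 - MvPolynomial.monomial b 1)) = 0 := by
  induction g using MvPolynomial.induction_on' with
  | monomial c r =>
    have hc : MvPolynomial.monomial (c + a) 1 - MvPolynomial.monomial (c + b) 1 ∈ I := by
      simpa [mul_sub, MvPolynomial.monomial_mul] using
        I.mul_mem_left (MvPolynomial.monomial c 1) h
    have hiff : MvPolynomial.monomial v 1 - MvPolynomial.monomial (c + a) 1 ∈ I ↔
        MvPolynomial.monomial v 1 - MvPolynomial.monomial (c + b) 1 ∈ I := by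
      rw [← I.add_mem_iff_left hc, sub_add_sub_cancel]
    rw [mul_sub, MvPolynomial.monomial_mul, MvPolynomial.monomial_mul, map_sub,
      monomialClassSum_monomial, monomialClassSum_monomial]
    split_ifs with h₁ h₂ h₂
    · exact sub_self _
    · exact absurd (hiff.mp h₁) h₂
    · exact absurd (hiff.mpr h₂) h₁
    · exact sub_self _
  | add p q hp hq => rw [add_mul, map_add, hp, hq, add_zero]

theorem monomialClassSum_eq_zero_of_mem_span {σ R : Type*} [CommRing R]
    {S : Set (MvPolynomial σ R)}
    (hS : ∀ p ∈ S, ∃ a b : σ →₀ ℕ, p = MvPolynomial.monomial a 1 - MvPolynomial.monomial b 1)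
    (v : σ →₀ ℕ) {f : MvPolynomial σ R} (hf : f ∈ Ideal.span S) :
    monomialClassSum (Ideal.span S) v f = 0 := by
  suffices h : ∀ g, monomialClassSum (Ideal.span S) v (g * f) = 0 by simpa using h 1
  induction hf using Submodule.span_induction with
  | mem p hp =>
    obtain ⟨a, b, rfl⟩ := hS p hp
    exact monomialClassSum_mul_eq_zero v (Ideal.subset_span hp)
  | zero => simp
  | add p q _ _ hp hq => intro g; rw [mul_add, map_add, hp, hq, add_zero]
  | smul c p _ hp => intro g; rw [smul_eq_mul, ← mul_assoc, hp]

theorem statement_14 (k : Type*) [Field k] (n : ℕ)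
    (I : Ideal (MvPolynomial (Fin n) k))
    (S : Set (MvPolynomial (Fin n) k))
    (hS : ∀ p ∈ S, ∃ a b : Fin n →₀ ℕ,
      p = MvPolynomial.monomial a 1 - MvPolynomial.monomial b 1)
    (hI : I = Ideal.span S)
    (f : MvPolynomial (Fin n) k) (hf : f ∈ I)
    (v : Fin n →₀ ℕ) (hv : MvPolynomial.coeff v f ≠ 0) :
    ∃ v' : Fin n →₀ ℕ, v' ≠ v ∧ MvPolynomial.coeff v' f ≠ 0 ∧
      MvPolynomial.monomial v 1 - MvPolynomial.monomial v' 1 ∈ I := by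
  subst hI
  by_contra! hne
  apply hv
  have hzero := monomialClassSum_eq_zero_of_mem_span hS v hf
  rw [f.as_sum, map_sum, Finset.sum_eq_single_of_mem v (MvPolynomial.mem_support_iff.mpr hv)]
    at hzero
  · simpa [monomialClassSum_monomial] using hzero
  · intro a ha hav
    rw [monomialClassSum_monomial, if_neg (hne a hav (MvPolynomial.mem_support_iff.mp ha))]
end

section
/- Let n ≥ 1, d ≥ 1, and ℓ, ℓ′ be natural numbers, let τ ⊆ ℤ^n be a finite set, and let π : τ → Δ_ℓ(d) and π′ : τ → Δ_{ℓ′}(d) be maps whose images are concise. Suppose there exist maps φ : {0,…,ℓ} → {0,…,ℓ′} and ψ : {0,…,ℓ′} → {0,…,ℓ} such that π′ = φ_* ∘ π and π = ψ_* ∘ π′. Then ℓ = ℓ′ and there exists a bijection σ of {0,…,ℓ} with π′ = σ_* ∘ π; that is, π and π′ are equivalent. (This is the antisymmetry, on a fixed face, of the partial order ≤ on Cayley structures: π ≤ π′ ≤ π implies π and π′ are equivalent.) -/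
/-- `pushf φ` is the linear map `ℤ^m → ℤ^{m'}` sending the standard basis
vector `e i` to `e (φ i)`. -/
def pushf {m m' : ℕ} (φ : Fin m → Fin m') (v : Fin m → ℤ) : Fin m' → ℤ :=
  fun j => ∑ i, if φ i = j then v i else 0

/-- A map pushing a family of vectors forward to a concise family is surjective. -/
theorem surjective_of_concise_image_pushf {α : Type*} {m m' : ℕ} {τ : Set α}
    {p : α → Fin m → ℤ} {p' : α → Fin m' → ℤ} {f : Fin m → Fin m'}
    (hc : Concise (p' '' τ)) (hf : ∀ u ∈ τ, p' u = pushf f (p u)) :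
    Function.Surjective f := by
  intro j
  obtain ⟨_, ⟨u, hu, rfl⟩, hj⟩ := hc j
  rw [hf u hu] at hj
  obtain ⟨i, -, hi⟩ := Finset.exists_ne_zero_of_sum_ne_zero hj
  exact ⟨i, by_contra fun h => hi (if_neg h)⟩

theorem statement_15 (n d ℓ ℓ' : ℕ) (hn : 1 ≤ n) (hd : 1 ≤ d)
    (τ : Set (Fin n → ℤ)) (hτ : τ.Finite)
    (π : (Fin n → ℤ) → (Fin (ℓ + 1) → ℤ))
    (π' : (Fin n → ℤ) → (Fin (ℓ' + 1) → ℤ))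
    (hπΔ : ∀ u ∈ τ, π u ∈ Delta (ℓ + 1) d)
    (hπ'Δ : ∀ u ∈ τ, π' u ∈ Delta (ℓ' + 1) d)
    (hπc : Concise (π '' τ))
    (hπ'c : Concise (π' '' τ))
    (φ : Fin (ℓ + 1) → Fin (ℓ' + 1)) (ψ : Fin (ℓ' + 1) → Fin (ℓ + 1))
    (hφ : ∀ u ∈ τ, π' u = pushf φ (π u))
    (hψ : ∀ u ∈ τ, π u = pushf ψ (π' u)) :
    ℓ = ℓ' ∧ ∃ σ : Fin (ℓ + 1) ≃ Fin (ℓ' + 1), ∀ u ∈ τ, π' u = pushf (⇑σ) (π u) := by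
  have hφs := surjective_of_concise_image_pushf hπ'c hφ
  have hψs := surjective_of_concise_image_pushf hπc hψ
  have hle : ℓ' + 1 ≤ ℓ + 1 := by simpa using Fintype.card_le_of_surjective φ hφs
  have hge : ℓ + 1 ≤ ℓ' + 1 := by simpa using Fintype.card_le_of_surjective ψ hψs
  obtain rfl : ℓ = ℓ' := by omega
  exact ⟨rfl, Equiv.ofBijective φ (Finite.surjective_iff_bijective.mp hφs), hφ⟩
end
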